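/- arXiv:1806.10731 — 2 statements merged into one kernel-verified Lean document; each statement's English description precedes it below -/
import Mathlib

section
/- For n ≥ 3 with n odd and n ≢ 0 (mod 3), the wheel graph W_{n+1} = K_1 + C_n does not admit a J-colouring. -/
open SimpleGraph

/-- `c` is a proper colouring of `G` with colours `Fin k` such that the closed
neighbourhood of every vertex contains all `k` colours (a J-colouring). -/
def IsJColoring {V : Type*} (G : SimpleGraph V) (k : ℕ) (c : V → Fin k) : Prop :=
  (∀ ⦃u v : V⦄, G.Adj u v → c u ≠ c v) ∧
  ∀ v : V, ∀ i : Fin k, ∃ u : V, (u = v ∨ G.Adj v u) ∧ c u = i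

/-- `G` has a J-colouring with `k` colours. -/
def HasJColoring {V : Type*} (G : SimpleGraph V) (k : ℕ) : Prop :=
  ∃ c : V → Fin k, IsJColoring G k c

/-- `G` admits a J-colouring (with some number `k ≥ 1` of colours). -/
def AdmitsJColoring {V : Type*} (G : SimpleGraph V) : Prop :=
  ∃ k : ℕ, 1 ≤ k ∧ HasJColoring G k

/-- `c` is a proper colouring of `G` with colours `Fin k` such that the closed
neighbourhood of every internal vertex (vertex of degree at least 2) contains
all `k` colours (a J*-colouring). -/
def IsJStarColoring {V : Type*} (G : SimpleGraph V) (k : ℕ) (c : V → Fin k) : Prop :=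
  (∀ ⦃u v : V⦄, G.Adj u v → c u ≠ c v) ∧
  ∀ v : V, (∃ a b : V, a ≠ b ∧ G.Adj v a ∧ G.Adj v b) →
    ∀ i : Fin k, ∃ u : V, (u = v ∨ G.Adj v u) ∧ c u = i

/-- `G` has a J*-colouring with `k` colours. -/
def HasJStarColoring {V : Type*} (G : SimpleGraph V) (k : ℕ) : Prop :=
  ∃ c : V → Fin k, IsJStarColoring G k c

/-- The wheel graph `W_{n+1} = K_1 + C_n`: the cycle graph on `Fin n` together
with a central vertex `none` adjacent to every cycle vertex. -/
def wheelGraph (n : ℕ) : SimpleGraph (Option (Fin n)) :=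
  SimpleGraph.fromRel (fun u v =>
    (∃ i : Fin n, u = none ∧ v = some i) ∨
    (∃ i j : Fin n, u = some i ∧ v = some j ∧ (SimpleGraph.cycleGraph n).Adj i j))

/-- The Jahangir graph `J_{n,m}`: the cycle graph on `Fin (n*m)` together with a
central vertex `none` adjacent exactly to the `m` cycle vertices whose index is
a multiple of `n`. -/
def jahangirGraph (n m : ℕ) : SimpleGraph (Option (Fin (n * m))) :=
  SimpleGraph.fromRel (fun u v =>
    (∃ i : Fin (n * m), u = none ∧ v = some i ∧ n ∣ (i : ℕ)) ∨
    (∃ i j : Fin (n * m), u = some i ∧ v = some j ∧ (SimpleGraph.cycleGraph (n * m)).Adj i j))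

theorem wheelGraph_adj_none_some {n : ℕ} (i : Fin n) : (wheelGraph n).Adj none (some i) := by
  simp [wheelGraph]

theorem wheelGraph_adj_some_some {n : ℕ} {i j : Fin n} :
    (wheelGraph n).Adj (some i) (some j) ↔ (cycleGraph n).Adj i j := by
  simp only [wheelGraph, fromRel_adj, ne_eq, Option.some.injEq, reduceCtorEq, false_and,
    exists_false, false_or]
  constructor
  · rintro ⟨-, ⟨i, j, rfl, rfl, h⟩ | ⟨i, j, rfl, rfl, h⟩⟩
    exacts [h, h.symm]
  · exact fun h ↦ ⟨h.ne, Or.inl ⟨i, j, rfl, rfl, h⟩⟩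

/-- A periodic colour sequence avoiding `z`, with distinct consecutive terms, in which any three
consecutive terms together with `z` exhaust the colours, has even period or period divisible
by `3`. -/
theorem even_or_three_dvd_of_periodic {α : Type*} {f : ℕ → α} {z : α} {n : ℕ}
    (hper : f.Periodic n) (hz : ∀ m, f m ≠ z) (hne : ∀ m, f m ≠ f (m + 1))
    (hcov : ∀ m i, i = z ∨ i = f m ∨ i = f (m + 1) ∨ i = f (m + 2)) :
    Even n ∨ 3 ∣ n := by
  have hn : f n = f 0 := by simpa using hper 0
  by_cases h : ∃ m, f m = f (m + 2)
  · left
    obtain ⟨m, hm⟩ := h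
    have h2 : f.Periodic 2 := fun j ↦ by
      have h0 := hcov m (f j)
      have h1 := hcov m (f (j + 1))
      have h2 := hcov m (f (j + 2))
      have := hne (j + 1)
      grind
    by_contra hodd
    rw [← h2.map_mod_nat n, Nat.odd_iff.mp (Nat.not_even_iff_odd.mp hodd)] at hn
    exact hne 0 hn.symm
  · right
    push Not at h
    have h3' : f.Periodic 3 := fun j ↦ by
      have h0 := hcov j (f (j + 3))
      have h1 := hne (j + 2)
      have h2 := h (j + 1)
      have := hz (j + 3)
      grind
    rw [← h3'.map_mod_nat n] at hn
    have : n % 3 = 0 ∨ n % 3 = 1 ∨ n % 3 = 2 := by omega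
    rcases this with h' | h' | h'
    · exact Nat.dvd_of_mod_eq_zero h'
    · exact absurd (h' ▸ hn).symm (hne 0)
    · exact absurd (h' ▸ hn).symm (h 0)

open Fin.CommRing in
/-- The rim of a wheel with a J-colouring has length even or divisible by `3`. -/
theorem IsJColoring.even_or_three_dvd {n k : ℕ} {c : Option (Fin (n + 2)) → Fin k}
    (hc : IsJColoring (wheelGraph (n + 2)) k c) : Even (n + 2) ∨ 3 ∣ n + 2 := by
  obtain ⟨hproper, hcover⟩ := hc
  let f : ℕ → Fin k := fun m ↦ c (some (m : Fin (n + 2)))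
  have hper : f.Periodic (n + 2) := fun m ↦ by
    simp only [f, Nat.cast_add m (n + 2), Fin.natCast_self, add_zero]
  have hz (m : ℕ) : f m ≠ c none := (hproper (wheelGraph_adj_none_some _)).symm
  have hne (m : ℕ) : f m ≠ f (m + 1) :=
    hproper (wheelGraph_adj_some_some.mpr (cycleGraph_adj.mpr (Or.inr (by simp))))
  have hcov (m : ℕ) (i : Fin k) :
      i = c none ∨ i = f m ∨ i = f (m + 1) ∨ i = f (m + 2) := by
    obtain ⟨u, hu, rfl⟩ := hcover (some ((m + 1 : ℕ) : Fin (n + 2))) i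
    rcases u with _ | u
    · exact Or.inl rfl
    rw [wheelGraph_adj_some_some, cycleGraph_adj] at hu
    rcases hu with hu | hu | hu
    · rw [hu]
      exact Or.inr (Or.inr (Or.inl rfl))
    · have : u = (m : Fin (n + 2)) := by
        push_cast at hu
        linear_combination -hu
      rw [this]
      exact Or.inr (Or.inl rfl)
    · have : u = ((m + 2 : ℕ) : Fin (n + 2)) := by
        push_cast at hu ⊢
        linear_combination hu
      rw [this]
      exact Or.inr (Or.inr (Or.inr rfl))
  exact even_or_three_dvd_of_periodic hper hz hne hcov

theorem stmt8 (n : ℕ) (hn : 3 ≤ n) (hodd : Odd n) (h3 : n % 3 ≠ 0) :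
    ¬ AdmitsJColoring (wheelGraph n) := by
  rintro ⟨k, -, c, hc⟩
  obtain ⟨n, rfl⟩ := Nat.exists_eq_add_of_le' (show 2 ≤ n by omega)
  rcases hc.even_or_three_dvd with h | h
  · exact Nat.not_even_iff_odd.mpr hodd h
  · exact h3 (Nat.mod_eq_zero_of_dvd h)
end

section
/- For every n ≥ 3 with n ≡ 0 (mod 3), the cycle graph C_n admits a J-colouring with 3 colours. -/
open SimpleGraph

/-- Adjacency in the cycle graph in terms of the values of the vertices. -/
theorem cycleGraph_adj_iff_val {n : ℕ} (hn : 2 ≤ n) (u v : Fin n) :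
    (SimpleGraph.cycleGraph n).Adj u v ↔
      (u : ℕ) + 1 = v ∨ (v : ℕ) + 1 = u ∨
        ((u : ℕ) = 0 ∧ (v : ℕ) + 1 = n) ∨ ((v : ℕ) = 0 ∧ (u : ℕ) + 1 = n) := by
  rw [SimpleGraph.cycleGraph_adj', Fin.val_sub, Fin.val_sub]
  have mod_eq_one : ∀ a b : Fin n, (n - (b : ℕ) + a) % n = 1 ↔
      (b : ℕ) + 1 = a ∨ ((a : ℕ) = 0 ∧ (b : ℕ) + 1 = n) := by
    intro a b
    rcases le_or_gt (b : ℕ) a with h | h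
    · rw [show n - (b : ℕ) + a = (a - b : ℕ) + n by omega, Nat.add_mod_right,
        Nat.mod_eq_of_lt (by omega)]
      omega
    · rw [Nat.mod_eq_of_lt (by omega)]
      omega
  rw [mod_eq_one, mod_eq_one]
  tauto

theorem stmt17 (n : ℕ) (hn : 3 ≤ n) (h3 : n % 3 = 0) :
    HasJColoring (SimpleGraph.cycleGraph n) 3 := by
  refine ⟨fun v => ⟨v % 3, Nat.mod_lt _ (by omega)⟩, ?_, ?_⟩
  · intro u v h
    rw [cycleGraph_adj_iff_val (by omega)] at h
    simp only [ne_eq, Fin.mk.injEq]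
    omega
  · intro v i
    simp only [cycleGraph_adj_iff_val (show 2 ≤ n by omega), Fin.ext_iff]
    have succ_or_zero : ∃ u : Fin n, (v : ℕ) + 1 = u ∨ ((u : ℕ) = 0 ∧ (v : ℕ) + 1 = n) := by
      by_cases h : (v : ℕ) + 1 = n
      · exact ⟨⟨0, by omega⟩, Or.inr ⟨rfl, h⟩⟩
      · exact ⟨⟨v + 1, by omega⟩, Or.inl rfl⟩
    have pred_or_last : ∃ u : Fin n, (u : ℕ) + 1 = v ∨ ((v : ℕ) = 0 ∧ (u : ℕ) + 1 = n) := by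
      by_cases h : (v : ℕ) = 0
      · exact ⟨⟨n - 1, by omega⟩, Or.inr ⟨h, by simp only; omega⟩⟩
      · exact ⟨⟨v - 1, by omega⟩, Or.inl (by simp only; omega)⟩
    obtain ⟨s, hs⟩ := succ_or_zero
    obtain ⟨p, hp⟩ := pred_or_last
    have colour_cases : (v : ℕ) % 3 = i ∨ (s : ℕ) % 3 = i ∨ (p : ℕ) % 3 = i := by omega
    rcases colour_cases with h | h | h
    · exact ⟨v, Or.inl rfl, h⟩
    · exact ⟨s, Or.inr (by tauto), h⟩
    · exact ⟨p, Or.inr (by tauto), h⟩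
end
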